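/- Let 0 < β < 1 and w(x) = (1 + |x|²)^{−β/2}. There exists a constant C > 0 such that for every real-valued Schwartz function f : ℝ → ℝ, ( ∫_ℝ |Λ^{1/2} f(x)|² w(x) dx )^{1/2} ≤ C ( ∫_ℝ |f(x)|² w(x) dx )^{1/4} ( ∫_ℝ |Λ f(x)|² w(x) dx )^{1/4}, where Λ^{1/2} f and Λ f are the functions with Fourier transforms |ξ|^{1/2} f̂(ξ) and |ξ| f̂(ξ), respectively. -/

import Mathlib

open MeasureTheory

/-- The Fourier transform normalized as `f̂(ξ) = (2π)^{-1/2} ∫ f(x) e^{-ixξ} dx`. -/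
noncomputable def fourierTrans (f : ℝ → ℂ) (ξ : ℝ) : ℂ :=
  (((2 * Real.pi) ^ (-(1 / 2 : ℝ)) : ℝ) : ℂ) *
    ∫ x : ℝ, f x * Complex.exp (-Complex.I * (x : ℂ) * (ξ : ℂ))

/-- The fractional Laplacian `Λ^s f`, the inverse Fourier transform of `|ξ|^s f̂(ξ)`. -/
noncomputable def fracLap (s : ℝ) (f : ℝ → ℂ) (x : ℝ) : ℂ :=
  (((2 * Real.pi) ^ (-(1 / 2 : ℝ)) : ℝ) : ℂ) *
    ∫ ξ : ℝ, ((|ξ| ^ s : ℝ) : ℂ) * fourierTrans f ξ * Complex.exp (Complex.I * (x : ℂ) * (ξ : ℂ))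

/-- The weight `w_β(x) = (1 + |x|²)^{−β/2}`. -/
noncomputable def wbeta (β x : ℝ) : ℝ := (1 + x ^ 2) ^ (-(β / 2))

open Set Filter Topology Complex in
lemma aux_split {φ : ℝ → ℂ} (h : Integrable φ) :
    ∫ ξ, φ ξ = (∫ ξ in Set.Ioi (0:ℝ), φ ξ) + ∫ ξ in Set.Ioi (0:ℝ), φ (-ξ) := by
  rw [integral_comp_neg_Ioi (0:ℝ) φ, neg_zero, add_comm]
  exact (intervalIntegral.integral_Iic_add_Ioi h.integrableOn h.integrableOn).symm

lemma aux_expabs_integrable {t : ℝ} (ht : 0 < t) (k : ℕ) :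
    Integrable (fun ξ : ℝ => |ξ| ^ k * Real.exp (-(t * |ξ|))) := by
  have h1 : IntegrableOn (fun ξ : ℝ => |ξ| ^ k * Real.exp (-(t * |ξ|))) (Set.Ioi 0) := by
    have := integrableOn_rpow_mul_exp_neg_mul_rpow (p := 1) (s := k) (b := t)
      (by have : (0:ℝ) ≤ k := by positivity
          linarith) one_pos ht
    refine this.congr_fun (fun x hx => ?_) measurableSet_Ioi
    have hx' : 0 < x := hx
    simp [abs_of_pos hx']
  have h2 : IntegrableOn (fun ξ : ℝ => |ξ| ^ k * Real.exp (-(t * |ξ|))) (Set.Iic 0) := by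
    rw [integrableOn_Iic_iff_integrableOn_Iio]
    have := (h1.integrable_indicator measurableSet_Ioi).comp_neg
    rw [← integrable_indicator_iff measurableSet_Iio]
    refine this.congr (Filter.Eventually.of_forall fun x => ?_)
    by_cases hx : x < 0
    · simp [Set.indicator, hx]
    · simp [Set.indicator, hx]
  have := h2.union h1
  rwa [Set.Iic_union_Ioi, integrableOn_univ] at this

noncomputable def Qk (t x : ℝ) : ℝ := t / (t ^ 2 + x ^ 2)

lemma Qk_nonneg {t : ℝ} (ht : 0 < t) (x : ℝ) : 0 ≤ Qk t x := by
  unfold Qk; positivity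

lemma Qk_cont {t : ℝ} (ht : 0 < t) : Continuous (Qk t) := by
  unfold Qk
  exact continuous_const.div (by fun_prop) (fun x => by positivity)

lemma Qk_eq {t : ℝ} (ht : 0 < t) (x : ℝ) : Qk t x = t⁻¹ * (1 + (x / t) ^ 2)⁻¹ := by
  unfold Qk; field_simp

lemma Qk_integrable {t : ℝ} (ht : 0 < t) : Integrable (Qk t) := by
  have := (integrable_inv_one_add_sq.comp_div ht.ne').const_mul t⁻¹
  exact this.congr (Filter.Eventually.of_forall fun x => (Qk_eq ht x).symm)

lemma Qk_integral {t : ℝ} (ht : 0 < t) : ∫ x, Qk t x = Real.pi := by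
  simp_rw [Qk_eq ht]
  rw [integral_const_mul, Measure.integral_comp_div (fun x : ℝ => (1 + x ^ 2)⁻¹) t,
    integral_univ_inv_one_add_sq, abs_of_pos ht, smul_eq_mul]
  field_simp

open Complex in
lemma aux_half0 {a : ℂ} (ha : 0 < a.re) :
    ∫ ξ in Set.Ioi (0:ℝ), exp (-a * ξ) = 1 / a := by
  rw [integral_exp_mul_complex_Ioi (by simpa using ha)]
  simp [neg_div_neg_eq]

open Complex in
lemma aux_tendsto {a : ℂ} (ha : 0 < a.re) (k : ℕ) :
    Filter.Tendsto (fun ξ : ℝ => (ξ:ℂ) ^ k * exp (-a * ξ)) Filter.atTop (nhds 0) := by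
  rw [tendsto_zero_iff_norm_tendsto_zero]
  have := tendsto_rpow_mul_exp_neg_mul_atTop_nhds_zero (k : ℝ) a.re ha
  refine this.congr' ?_
  filter_upwards [Filter.eventually_gt_atTop 0] with x hx
  simp [norm_exp, abs_of_pos hx]

open Complex in
lemma aux_integrable1 {a : ℂ} (ha : 0 < a.re) :
    IntegrableOn (fun ξ : ℝ => (ξ:ℂ) * exp (-a * ξ)) (Set.Ioi 0) := by
  have := (aux_expabs_integrable ha 1).integrableOn (s := Set.Ioi 0)
  refine Integrable.mono this (by fun_prop) ?_
  filter_upwards [ae_restrict_mem measurableSet_Ioi] with x hx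
  have hx' : 0 < x := hx
  simp [norm_exp, abs_of_pos hx']

open Complex in
lemma aux_half1 {a : ℂ} (ha : 0 < a.re) :
    ∫ ξ in Set.Ioi (0:ℝ), (ξ:ℂ) * exp (-a * ξ) = 1 / a ^ 2 := by
  have ha0 : a ≠ 0 := by rintro rfl; simp at ha
  have hd : ∀ x ∈ Set.Ici (0:ℝ), HasDerivAt
      (fun ξ : ℝ => -((ξ:ℂ) ^ 1 * exp (-a * ξ)) * (1/a) - (1 / a ^ 2) * ((ξ:ℂ) ^ 0 * exp (-a * ξ)))
      ((x:ℂ) * exp (-a * x)) x := by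
    intro x _
    have h0 : HasDerivAt (fun ξ : ℝ => (ξ : ℂ)) 1 x := ofRealCLM.hasDerivAt
    have h1 : HasDerivAt (fun ξ : ℝ => exp (-a * ξ)) (exp (-a * x) * (-a * 1)) x :=
      (h0.const_mul (-a)).cexp
    have h2 := ((h0.mul h1).neg.mul_const (1/a)).sub (h1.const_mul (1/a^2))
    simp only [pow_one, pow_zero, one_mul]
    convert! h2 using 1
    field_simp
    ring
  rw [integral_Ioi_of_hasDerivAt_of_tendsto' hd (aux_integrable1 ha)
    (m := -0 * (1/a) - (1/a^2) * 0)]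
  · simp
  · exact ((aux_tendsto ha 1).neg.mul_const _).sub ((aux_tendsto ha 0).const_mul _)

open Complex in
lemma aux_a_re (t z : ℝ) : ((t:ℂ) - I * z).re = t := by simp

open Complex in
lemma aux_FT0 {t : ℝ} (ht : 0 < t) (z : ℝ) :
    ∫ ξ : ℝ, ((Real.exp (-(t * |ξ|)) : ℝ) : ℂ) * exp (I * z * ξ) = ((2 * Qk t z : ℝ) : ℂ) := by
  have hInt : Integrable (fun ξ : ℝ => ((Real.exp (-(t * |ξ|)) : ℝ) : ℂ) * exp (I * z * ξ)) := by
    have := aux_expabs_integrable ht 0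
    simp only [pow_zero, one_mul] at this
    refine this.ofReal.mul_bdd (c := 1) (by fun_prop) (Filter.Eventually.of_forall fun x => ?_)
    simp [norm_exp]
  rw [aux_split hInt]
  have e1 : ∫ ξ in Set.Ioi (0:ℝ), ((Real.exp (-(t * |ξ|)) : ℝ) : ℂ) * exp (I * z * ξ)
      = 1 / ((t:ℂ) - I * z) := by
    rw [← aux_half0 (a := (t:ℂ) - I * z) (by rwa [aux_a_re])]
    refine setIntegral_congr_fun measurableSet_Ioi fun x hx => ?_
    have hx' : 0 < x := hx
    simp only [abs_of_pos hx']
    push_cast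
    rw [← exp_add]; ring_nf
  have e2 : ∫ ξ in Set.Ioi (0:ℝ), ((Real.exp (-(t * |-ξ|)) : ℝ) : ℂ) * exp (I * z * (-ξ : ℝ))
      = 1 / ((t:ℂ) - I * (-z : ℝ)) := by
    rw [← aux_half0 (a := (t:ℂ) - I * (-z:ℝ)) (by rwa [aux_a_re])]
    refine setIntegral_congr_fun measurableSet_Ioi fun x hx => ?_
    have hx' : 0 < x := hx
    simp only [abs_neg, abs_of_pos hx']
    push_cast
    rw [← exp_add]; ring_nf
  rw [e1, e2]
  have n1 : ((t:ℂ) - I * z) ≠ 0 := fun h => ht.ne' (by rw [← aux_a_re t z, h]; simp)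
  have n2 : ((t:ℂ) - I * (-z:ℝ)) ≠ 0 := fun h => ht.ne' (by rw [← aux_a_re t (-z), h]; simp)
  have n3 : (t:ℂ)^2 + (z:ℂ)^2 ≠ 0 := by
    norm_cast; positivity
  unfold Qk
  push_cast at n2 ⊢
  rw [div_add_div _ _ n1 n2, ← mul_div_assoc]
  have : ((t:ℂ) - I * z) * (t - I * -z) = (t:ℂ)^2 + (z:ℂ)^2 := by
    linear_combination (-(z:ℂ)^2) * I_sq
  rw [this]; ring_nf

open Complex in
lemma aux_K_bound {t : ℝ} (ht : 0 < t) (z : ℝ) :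
    ‖∫ ξ : ℝ, ((|ξ| * Real.exp (-(t * |ξ|)) : ℝ) : ℂ) * exp (I * z * ξ)‖ ≤ 2 / t * Qk t z := by
  have hInt : Integrable
      (fun ξ : ℝ => ((|ξ| * Real.exp (-(t * |ξ|)) : ℝ) : ℂ) * exp (I * z * ξ)) := by
    have := aux_expabs_integrable ht 1
    simp only [pow_one] at this
    refine this.ofReal.mul_bdd (c := 1) (by fun_prop) (Filter.Eventually.of_forall fun x => ?_)
    simp [norm_exp]
  rw [aux_split hInt]
  have e1 : ∫ ξ in Set.Ioi (0:ℝ), ((|ξ| * Real.exp (-(t * |ξ|)) : ℝ) : ℂ) * exp (I * z * ξ)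
      = 1 / ((t:ℂ) - I * z) ^ 2 := by
    rw [← aux_half1 (a := (t:ℂ) - I * z) (by rwa [aux_a_re])]
    refine setIntegral_congr_fun measurableSet_Ioi fun x hx => ?_
    have hx' : 0 < x := hx
    simp only [abs_of_pos hx']
    push_cast
    rw [mul_assoc, ← exp_add]; ring_nf
  have e2 : ∫ ξ in Set.Ioi (0:ℝ), ((|-ξ| * Real.exp (-(t * |-ξ|)) : ℝ) : ℂ) * exp (I * z * (-ξ : ℝ))
      = 1 / ((t:ℂ) - I * (-z : ℝ)) ^ 2 := by
    rw [← aux_half1 (a := (t:ℂ) - I * (-z:ℝ)) (by rwa [aux_a_re])]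
    refine setIntegral_congr_fun measurableSet_Ioi fun x hx => ?_
    have hx' : 0 < x := hx
    simp only [abs_neg, abs_of_pos hx']
    push_cast
    rw [mul_assoc, ← exp_add]; ring_nf
  rw [e1, e2]
  have hn : ∀ z : ℝ, ‖1 / ((t:ℂ) - I * z) ^ 2‖ = 1 / (t ^ 2 + z ^ 2) := by
    intro z
    rw [norm_div, norm_one, norm_pow, ← normSq_eq_norm_sq, normSq_apply]
    simp; ring
  refine (norm_add_le _ _).trans ?_
  rw [hn, hn, neg_sq]
  unfold Qk
  apply le_of_eq
  field_simp; ring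

open Complex FourierTransform in
lemma aux_FTQ {t : ℝ} (ht : 0 < t) (s : ℝ) :
    ∫ z : ℝ, ((Qk t z : ℝ) : ℂ) * exp (-I * z * s) =
      ((Real.pi * Real.exp (-(t * |s|)) : ℝ) : ℂ) := by
  set g : ℝ → ℂ := fun ξ => ((Real.exp (-(t * |ξ|)) : ℝ) : ℂ) with hg
  have hgi : Integrable g := by
    have := aux_expabs_integrable ht 0
    simp only [pow_zero, one_mul] at this
    exact this.ofReal
  have hFg : 𝓕 g = fun v => ((2 * Qk t (v * (2 * Real.pi)) : ℝ) : ℂ) := by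
    ext v
    rw [Real.fourier_real_eq_integral_exp_smul]
    have := aux_FT0 ht (-(v * (2 * Real.pi)))
    have hQ : Qk t (-(v * (2 * Real.pi))) = Qk t (v * (2 * Real.pi)) := by unfold Qk; simp
    rw [hQ] at this
    rw [← this]
    congr 1; ext ξ
    rw [smul_eq_mul, mul_comm]
    congr 2; push_cast; ring
  have h2pi : (2 * Real.pi) ≠ 0 := by positivity
  have hFi : Integrable (𝓕 g) := by
    rw [hFg]
    exact (((Qk_integrable ht).comp_mul_right' h2pi).const_mul 2).ofReal
  have inv := (show Continuous g by rw [hg]; fun_prop).fourierInv_fourier_eq hgi hFi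
  have inv' := congrFun inv (-s)
  rw [Real.fourierInv_eq', hFg] at inv'
  have := Measure.integral_comp_mul_right
    (fun z : ℝ => 2 * (((Qk t z : ℝ) : ℂ) * exp (-I * z * s))) (2 * Real.pi)
  have e : (∫ v : ℝ, exp (↑(2 * Real.pi * inner ℝ v (-s)) * I) •
      ((2 * Qk t (v * (2 * Real.pi)) : ℝ) : ℂ)) =
      ∫ x : ℝ, (2 * (((Qk t (x * (2 * Real.pi)) : ℝ) : ℂ) *
        exp (-I * ((x * (2 * Real.pi) : ℝ) : ℂ) * s))) := by
    congr 1; ext v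
    rw [smul_eq_mul, mul_comm]
    push_cast
    rw [mul_assoc]
    congr 3
    simp
    ring
  rw [e, this, integral_const_mul, abs_of_pos (by positivity)] at inv'
  simp only [hg, abs_neg, real_smul] at inv'
  push_cast at inv' ⊢
  rw [← inv']
  have : (Real.pi : ℂ) ≠ 0 := by exact_mod_cast Real.pi_ne_zero
  generalize (∫ (a : ℝ), (Qk t a : ℂ) * exp (-I * a * s)) = J
  field_simp
open ENNReal in
lemma aux_CS {α : Type*} [MeasurableSpace α] {μ : Measure α} {a b : α → ℝ≥0∞}
    (ha : AEMeasurable a μ) (hb : AEMeasurable b μ) :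
    (∫⁻ x, a x * b x ∂μ) ^ 2 ≤ (∫⁻ x, a x ∂μ) * ∫⁻ x, a x * b x ^ 2 ∂μ := by
  have h := ENNReal.lintegral_mul_le_Lp_mul_Lq μ Real.HolderConjugate.two_two
    (f := fun x => a x ^ (1/2 : ℝ)) (g := fun x => a x ^ (1/2 : ℝ) * b x)
    (ha.pow_const _) ((ha.pow_const _).mul hb)
  have hsq : ∀ y : ℝ≥0∞, (y ^ (1/2:ℝ)) ^ 2 = y := fun y => by
    rw [← ENNReal.rpow_natCast, ← ENNReal.rpow_mul]; norm_num
  have e1 : (∫⁻ x, ((fun x => a x ^ (1/2 : ℝ)) * (fun x => a x ^ (1/2 : ℝ) * b x)) x ∂μ)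
      = ∫⁻ x, a x * b x ∂μ := by
    refine lintegral_congr fun x => ?_
    simp only [Pi.mul_apply]
    rw [← mul_assoc, ← sq, hsq]
  rw [e1] at h
  calc _ ≤ _ := pow_le_pow_left' h 2
    _ = _ := by
      rw [mul_pow, hsq, hsq]
      congr 1
      · refine lintegral_congr fun x => ?_
        rw [ENNReal.rpow_two, hsq]
      · refine lintegral_congr fun x => ?_
        rw [ENNReal.rpow_two, mul_pow, hsq]

open ENNReal in
lemma aux_Qlint {t : ℝ} (ht : 0 < t) (x : ℝ) :
    ∫⁻ y, ENNReal.ofReal (Qk t (x - y)) = ENNReal.ofReal Real.pi := by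
  rw [← ofReal_integral_eq_lintegral_ofReal ((Qk_integrable ht).comp_sub_left x)
    (Filter.Eventually.of_forall fun y => Qk_nonneg ht _), integral_sub_left_eq_self (Qk t) volume x,
    Qk_integral ht]

lemma aux_cmp {β a b : ℝ} (h0 : 0 < β) (h1 : β < 1) (ha : 0 < a) (hab : a ≤ 4 * b) :
    b ^ (-(β/2)) ≤ 2 * a ^ (-(β/2)) := by
  have h4 : a / 4 ≤ b := by linarith
  calc b ^ (-(β/2)) ≤ (a/4) ^ (-(β/2)) :=
        Real.rpow_le_rpow_of_nonpos (by positivity) h4 (by linarith)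
    _ = a ^ (-(β/2)) * 4 ^ (β/2) := by
        rw [Real.div_rpow ha.le (by norm_num), Real.rpow_neg (by norm_num : (0:ℝ) ≤ 4)]
        field_simp
    _ ≤ a ^ (-(β/2)) * 2 := by
        gcongr
        calc (4:ℝ) ^ (β/2) ≤ 4 ^ (1/2:ℝ) :=
              Real.rpow_le_rpow_of_exponent_le (by norm_num) (by linarith)
          _ = 2 := by
              rw [← Real.sqrt_eq_rpow]
              rw [show (4:ℝ) = 2 ^ 2 by norm_num]; simp
    _ = _ := by ring

lemma wbeta_nonneg (β x : ℝ) : 0 ≤ wbeta β x := by unfold wbeta; positivity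
lemma wbeta_pos (β x : ℝ) : 0 < wbeta β x := by unfold wbeta; positivity

lemma wbeta_cont (β : ℝ) : Continuous (wbeta β) := by
  unfold wbeta
  exact Continuous.rpow_const (by fun_prop) (fun x => Or.inl (by positivity))

lemma wbeta_le_one {β : ℝ} (h0 : 0 < β) (x : ℝ) : wbeta β x ≤ 1 := by
  unfold wbeta
  exact Real.rpow_le_one_of_one_le_of_nonpos (by nlinarith [sq_nonneg x]) (by linarith)

open ENNReal in
lemma aux_even {φ : ℝ → ℝ≥0∞} (he : ∀ x, φ (-x) = φ x) :
    ∫⁻ x, φ x = 2 * ∫⁻ x in Set.Ioi 0, φ x := by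
  have h1 : ∫⁻ x in Set.Iio 0, φ x = ∫⁻ x in Set.Ioi 0, φ x := by
    have := (Measure.measurePreserving_neg (volume : Measure ℝ)).setLIntegral_comp_preimage_emb
      (MeasurableEquiv.neg ℝ).measurableEmbedding φ (Set.Ioi 0)
    rw [← this]
    simp [he]
  have h2 : ∫⁻ x in Set.Iic 0, φ x = ∫⁻ x in Set.Iio 0, φ x :=
    setLIntegral_congr Iio_ae_eq_Iic.symm
  rw [← lintegral_add_compl φ (measurableSet_Ioi (a := (0:ℝ))), Set.compl_Ioi, h2, h1, two_mul]

open ENNReal in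
lemma aux_rpowint {r a : ℝ} (hr : -1 < r) (ha : 0 ≤ a) :
    ∫⁻ y in Set.Ioc 0 a, ENNReal.ofReal (y ^ r) = ENNReal.ofReal (a ^ (r+1) / (r+1)) := by
  have hi : IntervalIntegrable (fun y : ℝ => y ^ r) volume 0 a :=
    intervalIntegral.intervalIntegrable_rpow' hr
  rw [intervalIntegrable_iff_integrableOn_Ioc_of_le ha] at hi
  rw [← ofReal_integral_eq_lintegral_ofReal hi, ← intervalIntegral.integral_of_le ha,
    integral_rpow (Or.inl hr), Real.zero_rpow (by linarith), sub_zero]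
  filter_upwards [ae_restrict_mem measurableSet_Ioc] with y hy
  exact Real.rpow_nonneg hy.1.le _

open ENNReal in
lemma aux_abspow {β a : ℝ} (h1 : β < 1) (ha : 0 ≤ a) :
    ∫⁻ y, Set.indicator {y : ℝ | |y| ≤ a} (fun y => ENNReal.ofReal (|y| ^ (-β))) y
      = 2 * ENNReal.ofReal (a ^ (1-β) / (1-β)) := by
  rw [aux_even (by intro x; simp [Set.indicator])]
  congr 1
  rw [show (1 - β) = -β + 1 by ring, ← aux_rpowint (by linarith) ha,
    ← lintegral_indicator measurableSet_Ioi, ← lintegral_indicator measurableSet_Ioc]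
  refine lintegral_congr fun y => ?_
  by_cases hy : 0 < y
  · by_cases hy2 : y ≤ a
    · simp [Set.indicator, hy, hy2, abs_of_pos hy]
    · simp [Set.indicator, hy, hy2, abs_of_pos hy]
  · simp [Set.indicator, hy]

open ENNReal in
lemma aux_A1 {β : ℝ} (h0 : 0 < β) (h1 : β < 1) :
    ∃ C : ℝ, 0 < C ∧ ∀ t > 0, ∀ x : ℝ,
      ∫⁻ y, ENNReal.ofReal (Qk t (x - y)) * ENNReal.ofReal (wbeta β y) ≤
        ENNReal.ofReal C * ENNReal.ofReal (wbeta β x) := by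
  have hb : 0 < 1 - β := by linarith
  refine ⟨2 * Real.pi + 4 / (1 - β), by positivity, fun t ht x => ?_⟩
  have hfirst : ∀ y, 1 + x ^ 2 ≤ 4 * (1 + y ^ 2) →
      ENNReal.ofReal (Qk t (x - y)) * ENNReal.ofReal (wbeta β y) ≤
      ENNReal.ofReal (2 * wbeta β x) * ENNReal.ofReal (Qk t (x - y)) := by
    intro y hy
    rw [mul_comm]
    gcongr
    exact aux_cmp h0 h1 (by positivity) hy
  have hI : ∫⁻ y, ENNReal.ofReal (2 * wbeta β x) * ENNReal.ofReal (Qk t (x - y)) =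
      ENNReal.ofReal (2 * Real.pi * wbeta β x) := by
    have hm : Measurable fun y => ENNReal.ofReal (Qk t (x - y)) :=
      ENNReal.measurable_ofReal.comp ((Qk_cont ht).measurable.comp (by fun_prop))
    rw [lintegral_const_mul _ hm, aux_Qlint ht, ← ENNReal.ofReal_mul (by have := wbeta_nonneg β x; positivity)]
    ring_nf
  rw [← ENNReal.ofReal_mul (by positivity), add_mul,
    ENNReal.ofReal_add (by have := wbeta_nonneg β x; positivity) (by have := wbeta_nonneg β x; positivity)]
  by_cases hx : |x| ≤ 1
  · refine le_trans ?_ le_self_add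
    rw [← hI]
    refine lintegral_mono fun y => hfirst y ?_
    have : x ^ 2 ≤ 1 := by rw [← sq_abs]; nlinarith [abs_nonneg x]
    nlinarith [sq_nonneg y]
  · push Not at hx
    have hx0 : 0 < |x| := by linarith
    have key : ∀ᵐ y : ℝ, ENNReal.ofReal (Qk t (x - y)) * ENNReal.ofReal (wbeta β y) ≤
        ENNReal.ofReal (2 * wbeta β x) * ENNReal.ofReal (Qk t (x - y)) +
        ENNReal.ofReal (|x|⁻¹) *
          Set.indicator {y : ℝ | |y| ≤ |x|} (fun y => ENNReal.ofReal (|y| ^ (-β))) y := by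
      have hne : ∀ᵐ y : ℝ, y ≠ 0 := by simp [ae_iff, measure_singleton]
      filter_upwards [hne] with y hy
      by_cases hyx : |x| ≤ 2 * |y|
      · refine (hfirst y ?_).trans le_self_add
        have := mul_self_le_mul_self hx0.le hyx
        nlinarith [sq_abs x, sq_abs y]
      · push Not at hyx
        refine le_trans ?_ le_add_self
        have hmem : y ∈ {y : ℝ | |y| ≤ |x|} := by
          have := abs_nonneg y
          show |y| ≤ |x|; linarith
        rw [Set.indicator_of_mem hmem]
        gcongr
        · unfold Qk
          have hxy : |x| ≤ 2 * |x - y| := by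
            have := abs_sub_abs_le_abs_sub x y
            linarith
          have h2 := mul_self_le_mul_self hx0.le hxy
          have h3 : |x - y| * |x - y| = (x-y)^2 := by rw [← sq, sq_abs]
          rw [div_le_iff₀ (by positivity), inv_mul_eq_div, le_div_iff₀ hx0]
          nlinarith [sq_nonneg (t - |x|/2)]
        · unfold wbeta
          have hy2 : 0 < |y| := abs_pos.mpr hy
          calc (1 + y ^ 2) ^ (-(β/2)) ≤ (|y| ^ 2) ^ (-(β/2)) := by
                apply Real.rpow_le_rpow_of_nonpos (by positivity) _ (by linarith)
                rw [sq_abs]; linarith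
            _ = |y| ^ (-β) := by
                rw [← Real.rpow_natCast, ← Real.rpow_mul hy2.le]
                congr 1; push_cast; ring
    refine (lintegral_mono_ae key).trans ?_
    have hm : Measurable fun y => ENNReal.ofReal (2 * wbeta β x) * ENNReal.ofReal (Qk t (x - y)) :=
      (ENNReal.measurable_ofReal.comp ((Qk_cont ht).measurable.comp (by fun_prop))).const_mul _
    rw [lintegral_add_left hm, hI, lintegral_const_mul' _ _ ENNReal.ofReal_ne_top,
      aux_abspow h1 hx0.le]
    gcongr
    rw [show (2:ℝ≥0∞) = ENNReal.ofReal 2 by simp, ← ENNReal.ofReal_mul (by norm_num),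
      ← ENNReal.ofReal_mul (by positivity)]
    apply ENNReal.ofReal_le_ofReal
    have hw : |x| ^ (-β) ≤ 2 * wbeta β x := by
      have := aux_cmp (a := 1 + x ^ 2) (b := |x| ^ 2) h0 h1 (by positivity) (by
        rw [← sq_abs x]; nlinarith)
      rw [← Real.rpow_natCast, ← Real.rpow_mul hx0.le] at this
      rw [show ((2:ℕ):ℝ) * -(β/2) = -β by push_cast; ring] at this
      exact this
    have e : |x| ^ (1 - β) = |x| * |x| ^ (-β) := by
      rw [sub_eq_add_neg, Real.rpow_add hx0, Real.rpow_one]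
    rw [e]
    calc |x|⁻¹ * (2 * (|x| * |x| ^ (-β) / (1-β))) = 2 / (1-β) * |x| ^ (-β) := by
          field_simp
      _ ≤ 2 / (1-β) * (2 * wbeta β x) := by gcongr
      _ = _ := by ring

open ENNReal in
lemma aux_conv {β C : ℝ} (hC : ∀ t > 0, ∀ x : ℝ,
      ∫⁻ y, ENNReal.ofReal (Qk t (x - y)) * ENNReal.ofReal (wbeta β y) ≤
        ENNReal.ofReal C * ENNReal.ofReal (wbeta β x)) {t : ℝ} (ht : 0 < t)
    {g : ℝ → ℝ≥0∞} (hg : Measurable g) :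
    ∫⁻ x, (∫⁻ y, ENNReal.ofReal (Qk t (x - y)) * g y) ^ 2 * ENNReal.ofReal (wbeta β x) ≤
      ENNReal.ofReal Real.pi * ENNReal.ofReal C *
        ∫⁻ y, g y ^ 2 * ENNReal.ofReal (wbeta β y) := by
  have hQ := (Qk_cont ht).measurable
  have hw := (wbeta_cont β).measurable
  calc _ ≤ ∫⁻ x, (ENNReal.ofReal Real.pi * ∫⁻ y, ENNReal.ofReal (Qk t (x - y)) * g y ^ 2) *
          ENNReal.ofReal (wbeta β x) := by
        refine lintegral_mono fun x => ?_
        dsimp only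
        gcongr
        rw [← aux_Qlint ht x]
        exact aux_CS (by fun_prop) (by fun_prop)
    _ = ENNReal.ofReal Real.pi * ∫⁻ x, ∫⁻ y, ENNReal.ofReal (Qk t (x - y)) * g y ^ 2 *
          ENNReal.ofReal (wbeta β x) := by
        rw [← lintegral_const_mul' _ _ ENNReal.ofReal_ne_top]
        refine lintegral_congr fun x => ?_
        rw [mul_assoc, lintegral_mul_const' _ _ ENNReal.ofReal_ne_top]
    _ = ENNReal.ofReal Real.pi * ∫⁻ y, g y ^ 2 * ∫⁻ x, ENNReal.ofReal (Qk t (y - x)) *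
          ENNReal.ofReal (wbeta β x) := by
        rw [lintegral_lintegral_swap (by fun_prop)]
        congr 1
        refine lintegral_congr fun y => ?_
        rw [← lintegral_const_mul _ (by fun_prop)]
        refine lintegral_congr fun x => ?_
        have : Qk t (x - y) = Qk t (y - x) := by unfold Qk; ring_nf
        rw [this]; ring
    _ ≤ ENNReal.ofReal Real.pi * ∫⁻ y, g y ^ 2 * (ENNReal.ofReal C * ENNReal.ofReal (wbeta β y)) := by
        gcongr with y
        exact hC t ht y
    _ = _ := by
        rw [mul_assoc]
        congr 1
        rw [← lintegral_const_mul' _ _ ENNReal.ofReal_ne_top]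
        refine lintegral_congr fun y => ?_
        ring
noncomputable def cpi : ℝ := (2 * Real.pi) ^ (-(1 / 2 : ℝ))

lemma cpi_pos : 0 < cpi := by unfold cpi; positivity

lemma cpi_sq : cpi * cpi = 1 / (2 * Real.pi) := by
  unfold cpi
  rw [← Real.rpow_add (by positivity), show (-(1/2:ℝ)) + (-(1/2:ℝ)) = -1 by norm_num,
    Real.rpow_neg_one, one_div]

open Complex in
lemma aux_swap {a b : ℝ → ℂ} (ha : Integrable a) (hb : Integrable b) (x : ℝ) :
    ∫ ξ : ℝ, a ξ * (∫ y : ℝ, b y * exp (-I * y * ξ)) * exp (I * x * ξ) =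
      ∫ y : ℝ, b y * ∫ ξ : ℝ, a ξ * exp (I * (x - y : ℝ) * ξ) := by
  have h1 : ∀ ξ : ℝ, a ξ * (∫ y : ℝ, b y * exp (-I * y * ξ)) * exp (I * x * ξ) =
      ∫ y : ℝ, a ξ * b y * exp (I * (x - y : ℝ) * ξ) := by
    intro ξ
    rw [← integral_const_mul, ← integral_mul_const]
    congr 1; ext y
    rw [← mul_assoc, mul_assoc (a ξ * b y), ← exp_add]
    congr 2; push_cast; ring
  simp_rw [h1]
  rw [integral_integral_swap]
  · congr 1; ext y
    rw [← integral_const_mul]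
    congr 1; ext ξ; ring
  · refine (ha.mul_prod hb).mul_bdd (c := 1) (by fun_prop) (Filter.Eventually.of_forall fun p => ?_)
    simp [norm_exp]

open Complex FourierTransform in
lemma aux_schwartz (f : SchwartzMap ℝ ℝ) :
    ∃ Φ : SchwartzMap ℝ ℂ, fourierTrans (fun y => (f y : ℂ)) = Φ := by
  have h2pi : (2 * Real.pi) ≠ 0 := by positivity
  let g : SchwartzMap ℝ ℂ := SchwartzMap.postcompCLM (𝕜 := ℝ) ofRealCLM f
  let e : ℝ ≃L[ℝ] ℝ := ContinuousLinearEquiv.unitsEquivAut ℝ (Units.mk0 (2 * Real.pi)⁻¹ (by positivity))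
  refine ⟨(cpi : ℂ) • SchwartzMap.compCLMOfContinuousLinearEquiv ℂ e (𝓕 g), ?_⟩
  ext ξ
  simp only [smul_apply, SchwartzMap.compCLMOfContinuousLinearEquiv_apply,
    Function.comp_apply, SchwartzMap.fourier_coe, smul_eq_mul]
  unfold fourierTrans
  congr 1
  rw [Real.fourier_real_eq_integral_exp_smul]
  congr 1; ext y
  rw [smul_eq_mul, mul_comm]
  have he : e ξ = ξ * (2 * Real.pi)⁻¹ := by simp [e]
  rw [he]
  have : -2 * Real.pi * y * (ξ * (2 * Real.pi)⁻¹) = - y * ξ := by field_simp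
  rw [this]
  congr 2
  push_cast; ring

/-- `Λ P_t f`. -/
noncomputable def uP (f : ℝ → ℂ) (t x : ℝ) : ℂ :=
  (cpi : ℂ) * ∫ ξ : ℝ, ((|ξ| * Real.exp (-(t * |ξ|)) : ℝ) : ℂ) * fourierTrans f ξ *
    Complex.exp (Complex.I * (x : ℂ) * (ξ : ℂ))

lemma uP_meas {f : ℝ → ℂ} (hF : Continuous (fourierTrans f)) :
    StronglyMeasurable (fun p : ℝ × ℝ => uP f p.1 p.2) := by
  unfold uP
  apply StronglyMeasurable.const_mul
  apply StronglyMeasurable.integral_prod_right'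
    (f := fun q : (ℝ × ℝ) × ℝ => ((|q.2| * Real.exp (-(q.1.1 * |q.2|)) : ℝ) : ℂ) * fourierTrans f q.2 *
    Complex.exp (Complex.I * (q.1.2 : ℂ) * (q.2 : ℂ)))
  apply Continuous.stronglyMeasurable
  fun_prop

lemma fracLap_meas {f : ℝ → ℂ} (hF : Continuous (fourierTrans f)) {s : ℝ} (hs : 0 < s) :
    StronglyMeasurable (fracLap s f) := by
  unfold fracLap
  apply StronglyMeasurable.const_mul
  apply StronglyMeasurable.integral_prod_right'
    (f := fun q : ℝ × ℝ => ((|q.2| ^ s : ℝ) : ℂ) * fourierTrans f q.2 *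
    Complex.exp (Complex.I * (q.1 : ℂ) * (q.2 : ℂ)))
  apply Continuous.stronglyMeasurable
  have : Continuous fun q : ℝ × ℝ => |q.2| ^ s :=
    Continuous.rpow_const (by fun_prop) (fun _ => Or.inr hs.le)
  fun_prop

open Complex ENNReal in
lemma rep2 {f : ℝ → ℂ} (hf : Integrable f) {t : ℝ} (ht : 0 < t) (x : ℝ) :
    ENNReal.ofReal t * ‖uP f t x‖ₑ ≤ ∫⁻ y, ENNReal.ofReal (Qk t (x - y)) * ‖f y‖ₑ := by
  have hK : Integrable (fun ξ : ℝ => ((|ξ| * Real.exp (-(t * |ξ|)) : ℝ) : ℂ)) := by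
    have := aux_expabs_integrable ht 1
    simp only [pow_one] at this
    exact this.ofReal
  have e : uP f t x = ((1 / (2 * Real.pi) : ℝ) : ℂ) * ∫ y : ℝ, f y *
      ∫ ξ : ℝ, ((|ξ| * Real.exp (-(t * |ξ|)) : ℝ) : ℂ) * exp (I * (x - y : ℝ) * ξ) := by
    rw [← aux_swap hK hf x, ← cpi_sq]
    unfold uP fourierTrans
    rw [Complex.ofReal_mul, mul_assoc (cpi : ℂ) (cpi : ℂ)]
    congr 1
    rw [← integral_const_mul (cpi : ℂ)]
    refine integral_congr_ae (Filter.Eventually.of_forall fun ξ => ?_)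
    simp only
    rw [show (((2 * Real.pi) ^ (-(1 / 2 : ℝ)) : ℝ) : ℂ) = (cpi : ℂ) from rfl]
    ring
  have hb : ‖uP f t x‖ₑ ≤ ENNReal.ofReal (1 / (2 * Real.pi)) *
      ∫⁻ y, ‖f y‖ₑ * ENNReal.ofReal (2 / t * Qk t (x - y)) := by
    rw [e, enorm_mul]
    gcongr
    · rw [← ofReal_norm]
      apply ENNReal.ofReal_le_ofReal
      rw [Complex.norm_real, Real.norm_of_nonneg (by positivity)]
    · refine (enorm_integral_le_lintegral_enorm _).trans ?_
      gcongr with y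
      rw [enorm_mul]
      gcongr
      rw [← ofReal_norm]
      exact ENNReal.ofReal_le_ofReal (aux_K_bound ht (x - y))
  have e2 : ∫⁻ y, ‖f y‖ₑ * ENNReal.ofReal (2 / t * Qk t (x - y)) =
      ENNReal.ofReal (2 / t) * ∫⁻ y, ENNReal.ofReal (Qk t (x - y)) * ‖f y‖ₑ := by
    rw [← lintegral_const_mul' _ _ ENNReal.ofReal_ne_top]
    refine lintegral_congr fun y => ?_
    rw [ENNReal.ofReal_mul (by positivity)]; ring
  rw [e2] at hb
  calc _ ≤ ENNReal.ofReal t * (ENNReal.ofReal (1 / (2 * Real.pi)) * (ENNReal.ofReal (2 / t) *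
        ∫⁻ y, ENNReal.ofReal (Qk t (x - y)) * ‖f y‖ₑ)) := by gcongr
    _ = ENNReal.ofReal (t * (1 / (2 * Real.pi)) * (2 / t)) *
        ∫⁻ y, ENNReal.ofReal (Qk t (x - y)) * ‖f y‖ₑ := by
      rw [ENNReal.ofReal_mul (by positivity), ENNReal.ofReal_mul (by positivity)]; ring
    _ ≤ 1 * _ := by
      gcongr
      rw [ENNReal.ofReal_le_one]
      have := Real.pi_gt_three
      rw [show t * (1 / (2 * Real.pi)) * (2 / t) = 1 / Real.pi by field_simp]
      rw [div_le_one (by positivity)]; linarith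
    _ = _ := one_mul _

open Complex ENNReal in
lemma rep1 {f : ℝ → ℂ} (hG : Integrable (fun ξ : ℝ => ((|ξ| : ℝ) : ℂ) * fourierTrans f ξ))
    {t : ℝ} (ht : 0 < t) (x : ℝ) :
    ‖uP f t x‖ₑ ≤ ∫⁻ y, ENNReal.ofReal (Qk t (x - y)) * ‖fracLap 1 f y‖ₑ := by
  have hQ : Integrable (fun z : ℝ => ((Qk t z : ℝ) : ℂ)) := (Qk_integrable ht).ofReal
  have e : ((Real.pi : ℝ) : ℂ) * uP f t x = ∫ z : ℝ, ((Qk t z : ℝ) : ℂ) * fracLap 1 f (x - z) := by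
    have h := aux_swap hG hQ x
    simp_rw [aux_FTQ ht] at h
    unfold fracLap uP
    have : ∀ z : ℝ, ((Qk t z : ℝ) : ℂ) * ((((2 * Real.pi) ^ (-(1 / 2 : ℝ)) : ℝ) : ℂ) *
      ∫ ξ : ℝ, ((|ξ| ^ (1:ℝ) : ℝ) : ℂ) * fourierTrans f ξ * exp (I * ((x - z : ℝ) : ℂ) * ξ)) =
      (cpi : ℂ) * (((Qk t z : ℝ) : ℂ) *
      ∫ ξ : ℝ, ((|ξ| : ℝ) : ℂ) * fourierTrans f ξ * exp (I * ((x - z : ℝ) : ℂ) * ξ)) := by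
      intro z
      simp_rw [Real.rpow_one]
      rw [show (((2 * Real.pi) ^ (-(1 / 2 : ℝ)) : ℝ) : ℂ) = (cpi : ℂ) from rfl]
      ring
    simp_rw [this]
    rw [integral_const_mul, ← h, mul_left_comm, ← integral_const_mul]
    congr 2; ext ξ
    push_cast; ring
  have h1 : ‖uP f t x‖ₑ ≤ ‖((Real.pi : ℝ) : ℂ) * uP f t x‖ₑ := by
    rw [enorm_mul]
    refine le_mul_of_one_le_left zero_le ?_
    rw [← ofReal_norm, ENNReal.one_le_ofReal, Complex.norm_real,
      Real.norm_of_nonneg (by positivity)]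
    have := Real.pi_gt_three
    linarith
  refine h1.trans ?_
  rw [e]
  refine (enorm_integral_le_lintegral_enorm _).trans ?_
  rw [← lintegral_sub_left_eq_self _ x]
  refine lintegral_mono fun z => ?_
  rw [enorm_mul, _root_.sub_sub_cancel]
  gcongr
  rw [← ofReal_norm, Complex.norm_real, Real.norm_of_nonneg (Qk_nonneg ht _)]

lemma aux_gamma (ξ : ℝ) :
    ∫ t in Set.Ioi (0:ℝ), t ^ (-(1/2):ℝ) * (|ξ| * Real.exp (-(t * |ξ|))) =
      Real.sqrt Real.pi * |ξ| ^ (1/2:ℝ) := by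
  by_cases h : ξ = 0
  · subst h; simp
  have hξ : 0 < |ξ| := abs_pos.mpr h
  have := Real.integral_rpow_mul_exp_neg_mul_Ioi (a := 1/2) (r := |ξ|) (by norm_num) hξ
  rw [Real.Gamma_one_half_eq] at this
  calc _ = |ξ| * ∫ t in Set.Ioi (0:ℝ), t ^ ((1/2:ℝ) - 1) * Real.exp (-(|ξ| * t)) := by
        rw [← integral_const_mul]
        congr 1; ext t
        rw [show -(1/2:ℝ) = 1/2 - 1 by norm_num, mul_comm t]; ring
    _ = _ := by
        rw [this, Real.div_rpow zero_le_one hξ.le, Real.one_rpow]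
        have h2 : |ξ| = |ξ| ^ (1/2:ℝ) * |ξ| ^ (1/2:ℝ) := by
          rw [← Real.rpow_add hξ]; norm_num
        have : 0 < |ξ| ^ (1/2:ℝ) := by positivity
        nth_rewrite 1 [h2]
        field_simp

lemma aux_gamma_int (ξ : ℝ) :
    IntegrableOn (fun t : ℝ => t ^ (-(1/2):ℝ) * (|ξ| * Real.exp (-(t * |ξ|)))) (Set.Ioi 0) := by
  by_cases h : ξ = 0
  · subst h; simp
  have hξ : 0 < |ξ| := abs_pos.mpr h
  have := (integrableOn_rpow_mul_exp_neg_mul_rpow (p := 1) (s := -(1/2)) (b := |ξ|)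
    (by norm_num) one_pos hξ).const_mul |ξ|
  refine IntegrableOn.congr_fun this (fun t _ => ?_) measurableSet_Ioi
  simp only [Real.rpow_one, neg_mul]
  rw [mul_comm t]; ring

open Complex ENNReal in
lemma rep0 {f : ℝ → ℂ} (hF : Continuous (fourierTrans f))
    (hG : Integrable (fun ξ : ℝ => |ξ| ^ (1/2:ℝ) * ‖fourierTrans f ξ‖)) (x : ℝ) :
    ‖fracLap (1/2) f x‖ₑ ≤ ∫⁻ t in Set.Ioi (0:ℝ), ENNReal.ofReal (t ^ (-(1/2):ℝ)) * ‖uP f t x‖ₑ := by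
  set H : ℝ → ℝ → ℂ := fun t ξ => ((t ^ (-(1/2):ℝ) * (|ξ| * Real.exp (-(t * |ξ|))) : ℝ) : ℂ) *
    (fourierTrans f ξ * exp (I * x * ξ)) with hH
  have hn : ∀ ξ : ℝ, ‖fourierTrans f ξ * exp (I * x * ξ)‖ = ‖fourierTrans f ξ‖ := by
    intro ξ; simp [norm_exp]
  have hInt : Integrable (Function.uncurry H) ((volume.restrict (Set.Ioi (0:ℝ))).prod volume) := by
    rw [integrable_prod_iff']
    · constructor
      · refine Filter.Eventually.of_forall fun ξ => ?_
        have := (aux_gamma_int ξ).ofReal (𝕜 := ℂ)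
        exact this.mul_const (fourierTrans f ξ * exp (I * x * ξ))
      · refine (hG.const_mul (Real.sqrt Real.pi)).congr (Filter.Eventually.of_forall fun ξ => ?_)
        simp only [Function.uncurry_apply_pair, hH]
        rw [← mul_assoc, ← aux_gamma, ← integral_mul_const]
        refine setIntegral_congr_fun measurableSet_Ioi fun t ht => ?_
        have ht' : 0 < t := ht
        rw [norm_mul, hn, Complex.norm_real, Real.norm_of_nonneg (by positivity)]
    · apply Measurable.aestronglyMeasurable
      have : Measurable (fourierTrans f) := hF.measurable
      simp only [hH, Function.uncurry_def]
      fun_prop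
  have e : ((Real.sqrt Real.pi : ℝ) : ℂ) * fracLap (1/2) f x =
      ∫ t in Set.Ioi (0:ℝ), ((t ^ (-(1/2):ℝ) : ℝ) : ℂ) * uP f t x := by
    have hs := integral_integral_swap hInt
    have l : ∀ t : ℝ, ((t ^ (-(1/2):ℝ) : ℝ) : ℂ) * uP f t x = cpi * ∫ ξ, H t ξ := by
      intro t
      unfold uP
      rw [mul_left_comm, ← integral_const_mul]
      congr 2; ext ξ
      simp only [hH]
      push_cast; ring
    have r : ∀ ξ : ℝ, ∫ t in Set.Ioi (0:ℝ), H t ξ =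
        ((Real.sqrt Real.pi : ℝ) : ℂ) * (((|ξ| ^ (1/2:ℝ) : ℝ) : ℂ) * fourierTrans f ξ * exp (I * x * ξ)) := by
      intro ξ
      simp only [hH]
      rw [integral_mul_const, integral_complex_ofReal, aux_gamma]
      push_cast; ring
    simp_rw [l]
    rw [integral_const_mul, hs]
    simp_rw [r]
    rw [integral_const_mul]
    unfold fracLap
    rw [show (((2 * Real.pi) ^ (-(1 / 2 : ℝ)) : ℝ) : ℂ) = (cpi : ℂ) from rfl]
    ring
  have h1 : ‖fracLap (1/2) f x‖ₑ ≤ ‖((Real.sqrt Real.pi : ℝ) : ℂ) * fracLap (1/2) f x‖ₑ := by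
    rw [enorm_mul]
    refine le_mul_of_one_le_left zero_le ?_
    rw [← ofReal_norm, ENNReal.one_le_ofReal, Complex.norm_real,
      Real.norm_of_nonneg (by positivity), Real.one_le_sqrt]
    have := Real.pi_gt_three
    linarith
  refine h1.trans ?_
  rw [e]
  refine (enorm_integral_le_lintegral_enorm _).trans ?_
  refine setLIntegral_mono' measurableSet_Ioi fun t ht => ?_
  have ht' : 0 < t := ht
  rw [enorm_mul]
  gcongr
  rw [← ofReal_norm, Complex.norm_real, Real.norm_of_nonneg (by positivity)]
lemma schw_int (Φ : SchwartzMap ℝ ℂ) : Integrable (fun ξ : ℝ => (ξ : ℂ) * Φ ξ) := by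
  have h := Φ.integrable_pow_mul (volume : Measure ℝ) 1
  refine h.mono (by have := Φ.continuous; fun_prop) (Filter.Eventually.of_forall fun ξ => ?_)
  simp

open Complex in
lemma aux_ibp (Φ : SchwartzMap ℝ ℂ) : ∃ M : ℝ, ∀ x : ℝ,
    ‖(x : ℂ) * ∫ ξ in Set.Ioi (0:ℝ), (ξ : ℂ) * Φ ξ * exp (I * x * ξ)‖ ≤ M := by
  set D : SchwartzMap ℝ ℂ := SchwartzMap.derivCLM ℝ ℂ Φ with hD
  have hDi : Integrable (fun ξ : ℝ => Φ ξ + (ξ:ℂ) * D ξ) := Φ.integrable.add (schw_int D)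
  refine ⟨∫ ξ in Set.Ioi (0:ℝ), ‖Φ ξ + (ξ:ℂ) * D ξ‖, fun x => ?_⟩
  have hbd : ∀ ξ : ℝ, ‖exp (I * x * ξ)‖ = 1 := fun ξ => by simp [norm_exp]
  have hce : Continuous fun ξ : ℝ => exp (I * x * ξ) := by fun_prop
  have i1 : Integrable (fun ξ : ℝ => (Φ ξ + (ξ:ℂ) * D ξ) * exp (I * x * ξ)) :=
    hDi.mul_bdd (c := 1) hce.aestronglyMeasurable
      (Filter.Eventually.of_forall fun ξ => (hbd ξ).le)
  have i2 : Integrable (fun ξ : ℝ => (ξ:ℂ) * Φ ξ * exp (I * x * ξ)) :=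
    (schw_int Φ).mul_bdd (c := 1) hce.aestronglyMeasurable
      (Filter.Eventually.of_forall fun ξ => (hbd ξ).le)
  have hd : ∀ ξ : ℝ, HasDerivAt (fun ξ : ℝ => (ξ:ℂ) * Φ ξ * exp (I * x * ξ))
      ((Φ ξ + (ξ:ℂ) * D ξ) * exp (I * x * ξ) + I * x * ((ξ:ℂ) * Φ ξ * exp (I * x * ξ))) ξ := by
    intro ξ
    have h0 : HasDerivAt (fun ξ : ℝ => (ξ : ℂ)) 1 ξ := ofRealCLM.hasDerivAt
    have h1 : HasDerivAt (fun ξ : ℝ => exp (I * x * ξ)) (exp (I * x * ξ) * (I * x * 1)) ξ :=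
      (h0.const_mul (I * x)).cexp
    have h2 : HasDerivAt Φ (D ξ) ξ := by
      rw [hD, SchwartzMap.derivCLM_apply]; exact Φ.hasDerivAt ξ
    convert! (h0.mul h2).mul h1 using 1
    simp only [Pi.mul_apply]
    ring
  have i3 := (i1.add (i2.const_mul (I * x))).integrableOn (s := Set.Ioi 0)
  have hz := tendsto_zero_of_hasDerivAt_of_integrableOn_Ioi (a := 0) (fun ξ _ => hd ξ) i3
    i2.integrableOn
  have key := integral_Ioi_of_hasDerivAt_of_tendsto' (a := 0) (fun ξ _ => hd ξ) i3 hz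
  rw [integral_add i1.integrableOn (i2.const_mul (I * x)).integrableOn, integral_const_mul] at key
  simp only [ofReal_zero, zero_mul, sub_zero] at key
  have e : (x : ℂ) * ∫ ξ in Set.Ioi (0:ℝ), (ξ : ℂ) * Φ ξ * exp (I * x * ξ) =
      I * ∫ ξ in Set.Ioi (0:ℝ), (Φ ξ + (ξ:ℂ) * D ξ) * exp (I * x * ξ) := by
    linear_combination (-I) * key +
      ((x : ℂ) * ∫ ξ in Set.Ioi (0:ℝ), (ξ : ℂ) * Φ ξ * exp (I * x * ξ)) * I_sq
  rw [e, norm_mul, norm_I, one_mul]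
  refine (norm_integral_le_integral_norm _).trans (le_of_eq ?_)
  congr 1; ext ξ
  rw [norm_mul, hbd, mul_one]

open Complex in
lemma aux_decay {f : ℝ → ℂ} {Φ : SchwartzMap ℝ ℂ} (hΦ : fourierTrans f = Φ) :
    Integrable (fun x => ‖fracLap 1 f x‖ ^ 2) := by
  have hF : Continuous (fourierTrans f) := by rw [hΦ]; exact Φ.continuous
  set Ψ : SchwartzMap ℝ ℂ :=
    SchwartzMap.compCLMOfContinuousLinearEquiv ℂ (ContinuousLinearEquiv.neg ℝ) Φ with hΨ
  have hΨa : ∀ ξ, Ψ ξ = Φ (-ξ) := fun ξ => by simp [hΨ]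
  obtain ⟨M1, h1⟩ := aux_ibp Φ
  obtain ⟨M2, h2⟩ := aux_ibp Ψ
  have hbd : ∀ x ξ : ℝ, ‖exp (I * x * ξ)‖ = 1 := fun x ξ => by simp [norm_exp]
  have hi : Integrable (fun ξ : ℝ => ((|ξ| : ℝ) : ℂ) * Φ ξ) := by
    refine (schw_int Φ).mono (by have := Φ.continuous; fun_prop)
      (Filter.Eventually.of_forall fun ξ => ?_)
    simp
  have i2 : ∀ x : ℝ, Integrable (fun ξ : ℝ => ((|ξ| : ℝ) : ℂ) * Φ ξ * exp (I * x * ξ)) := fun x =>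
    hi.mul_bdd (c := 1) (by fun_prop) (Filter.Eventually.of_forall fun ξ => (hbd x ξ).le)
  have hL : ∀ x, fracLap 1 f x = (cpi : ℂ) * ∫ ξ : ℝ, ((|ξ| : ℝ) : ℂ) * Φ ξ * exp (I * x * ξ) := by
    intro x
    unfold fracLap
    simp_rw [Real.rpow_one, hΦ]
    rfl
  have hS : ∀ x : ℝ, ∫ ξ : ℝ, ((|ξ| : ℝ) : ℂ) * Φ ξ * exp (I * x * ξ) =
      (∫ ξ in Set.Ioi (0:ℝ), (ξ : ℂ) * Φ ξ * exp (I * x * ξ)) +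
      ∫ ξ in Set.Ioi (0:ℝ), (ξ : ℂ) * Ψ ξ * exp (I * (-x : ℝ) * ξ) := by
    intro x
    rw [aux_split (i2 x)]
    congr 1
    · refine setIntegral_congr_fun measurableSet_Ioi fun ξ hξ => ?_
      have hξ' : 0 < ξ := hξ
      simp only [abs_of_pos hξ']
    · refine setIntegral_congr_fun measurableSet_Ioi fun ξ hξ => ?_
      have hξ' : 0 < ξ := hξ
      simp only [abs_neg, abs_of_pos hξ', hΨa]
      push_cast; ring_nf
  have b1 : ∀ x : ℝ, |x| * ‖fracLap 1 f x‖ ≤ cpi * (M1 + M2) := by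
    intro x
    rw [hL, hS, norm_mul, Complex.norm_real, Real.norm_of_nonneg cpi_pos.le, mul_left_comm]
    have := cpi_pos
    gcongr
    have e : |x| = ‖(x:ℂ)‖ := by simp
    rw [e, ← norm_mul, mul_add]
    refine (norm_add_le _ _).trans (add_le_add (h1 x) ?_)
    refine le_trans (le_of_eq ?_) (h2 (-x))
    rw [norm_mul, norm_mul]; simp
  have b0 : ∀ x : ℝ, ‖fracLap 1 f x‖ ≤ cpi * ∫ ξ : ℝ, ‖((|ξ| : ℝ) : ℂ) * Φ ξ‖ := by
    intro x
    rw [hL, norm_mul, Complex.norm_real, Real.norm_of_nonneg cpi_pos.le]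
    have := cpi_pos
    gcongr
    refine (norm_integral_le_integral_norm _).trans (le_of_eq ?_)
    congr 1; ext ξ
    rw [norm_mul, hbd, mul_one]
  set B0 := cpi * ∫ ξ : ℝ, ‖((|ξ| : ℝ) : ℂ) * Φ ξ‖
  set B1 := cpi * (M1 + M2)
  refine (integrable_inv_one_add_sq.const_mul (B0 ^ 2 + B1 ^ 2)).mono
    ((fracLap_meas hF one_pos).norm.pow 2).aestronglyMeasurable
    (Filter.Eventually.of_forall fun x => ?_)
  rw [Real.norm_of_nonneg (by positivity), Real.norm_of_nonneg (by positivity),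
    ← div_eq_mul_inv, le_div_iff₀ (by positivity)]
  have c0 := pow_le_pow_left₀ (norm_nonneg _) (b0 x) 2
  have c1 := pow_le_pow_left₀ (by positivity) (b1 x) 2
  rw [mul_pow, sq_abs] at c1
  nlinarith
open ENNReal in
lemma aux_mink {μ : Measure ℝ} [SFinite μ] {a : ℝ → ℝ≥0∞} {V : ℝ → ℝ → ℝ≥0∞} {W : ℝ → ℝ≥0∞}
    (ha : Measurable a) (hV : Measurable (Function.uncurry V)) (hW : Measurable W) {K : ℝ≥0∞}
    (hK : ∀ᵐ t ∂μ, ∫⁻ x, V t x ^ 2 * W x ≤ K) :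
    ∫⁻ x, (∫⁻ t, a t * V t x ∂μ) ^ 2 * W x ≤ (∫⁻ t, a t ∂μ) ^ 2 * K := by
  have hV1 : ∀ x, Measurable fun t => V t x := fun x => hV.comp measurable_prodMk_right
  have hV2 : ∀ t, Measurable fun x => V t x := fun t => hV.comp measurable_prodMk_left
  have hV' : Measurable fun p : ℝ × ℝ => V p.2 p.1 := hV.comp measurable_swap
  have hm : Measurable fun x => ∫⁻ t, a t * V t x ^ 2 ∂μ := by
    apply Measurable.lintegral_prod_right'
      (f := fun p : ℝ × ℝ => a p.2 * V p.2 p.1 ^ 2)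
    fun_prop
  calc _ ≤ ∫⁻ x, (∫⁻ t, a t ∂μ) * ((∫⁻ t, a t * V t x ^ 2 ∂μ) * W x) := by
        refine lintegral_mono fun x => ?_
        rw [← mul_assoc]
        gcongr
        exact aux_CS ha.aemeasurable (hV1 x).aemeasurable
    _ = (∫⁻ t, a t ∂μ) * ∫⁻ x, ∫⁻ t, a t * V t x ^ 2 * W x ∂μ := by
        rw [lintegral_const_mul _ (f := fun x => (∫⁻ t, a t * V t x ^ 2 ∂μ) * W x) (hm.mul hW)]
        congr 1
        refine lintegral_congr fun x => ?_
        rw [lintegral_mul_const _ (f := fun t => a t * V t x ^ 2) (ha.mul ((hV1 x).pow_const 2))]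
    _ = (∫⁻ t, a t ∂μ) * ∫⁻ t, a t * (∫⁻ x, V t x ^ 2 * W x) ∂μ := by
        congr 1
        rw [lintegral_lintegral_swap]
        · refine lintegral_congr fun t => ?_
          have := hV2 t
          rw [← lintegral_const_mul (a t) (f := fun x => V t x ^ 2 * W x) (by fun_prop)]
          refine lintegral_congr fun x => ?_
          ring
        · apply Measurable.aemeasurable
          simp only [Function.uncurry_def]
          fun_prop
    _ ≤ (∫⁻ t, a t ∂μ) * ∫⁻ t, a t * K ∂μ := by
        refine mul_le_mul' le_rfl (lintegral_mono_ae ?_)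
        filter_upwards [hK] with t ht
        gcongr
    _ = _ := by
        rw [lintegral_mul_const _ ha]; ring

open ENNReal in
lemma aux_core {U : ℝ → ℝ → ℝ≥0∞} {W : ℝ → ℝ≥0∞}
    (hU : Measurable (Function.uncurry U)) (hW : Measurable W) {A B : ℝ≥0∞}
    (hB : ∀ t > 0, ∫⁻ x, U t x ^ 2 * W x ≤ B)
    (hA : ∀ t > 0, ∫⁻ x, (ENNReal.ofReal t * U t x) ^ 2 * W x ≤ A) {T : ℝ} (hT : 0 < T) :
    ∫⁻ x, (∫⁻ t in Set.Ioi (0:ℝ), ENNReal.ofReal (t ^ (-(1/2):ℝ)) * U t x) ^ 2 * W x ≤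
      ENNReal.ofReal (8 * T) * B + ENNReal.ofReal (8 / T) * A := by
  have m1 : Measurable fun t : ℝ => ENNReal.ofReal (t ^ (-(1/2):ℝ)) := by fun_prop
  have m3 : Measurable fun t : ℝ => ENNReal.ofReal (t ^ (-(3/2):ℝ)) := by fun_prop
  have I1 : ∫⁻ t in Set.Ioc 0 T, ENNReal.ofReal (t ^ (-(1/2):ℝ)) =
      ENNReal.ofReal (2 * T ^ (1/2:ℝ)) := by
    rw [aux_rpowint (by norm_num) hT.le]
    congr 1
    rw [show (-(1/2:ℝ)) + 1 = 1/2 by norm_num]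
    ring
  have I3 : ∫⁻ t in Set.Ioi T, ENNReal.ofReal (t ^ (-(3/2):ℝ)) =
      ENNReal.ofReal (2 * T ^ (-(1/2):ℝ)) := by
    rw [← ofReal_integral_eq_lintegral_ofReal (integrableOn_Ioi_rpow_of_lt (by norm_num) hT),
      integral_Ioi_rpow_of_lt (by norm_num) hT]
    · congr 1
      rw [show (-(3/2:ℝ)) + 1 = -(1/2) by norm_num]
      ring
    · filter_upwards [ae_restrict_mem measurableSet_Ioi] with t ht
      have : 0 < t := hT.trans ht
      simp only [Pi.zero_apply]
      positivity
  have S1 := aux_mink (μ := volume.restrict (Set.Ioc 0 T)) m1 hU hW (K := B) (by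
    filter_upwards [ae_restrict_mem measurableSet_Ioc] with t ht
    exact hB t ht.1)
  have S3 := aux_mink (μ := volume.restrict (Set.Ioi T)) (V := fun t x => ENNReal.ofReal t * U t x)
    m3 (by
      have : Measurable fun p : ℝ × ℝ => U p.1 p.2 := hU
      simp only [Function.uncurry_def]; fun_prop) hW (K := A) (by
    filter_upwards [ae_restrict_mem measurableSet_Ioi] with t ht
    exact hA t (hT.trans ht))
  rw [I1] at S1
  rw [I3] at S3
  have hsplit : ∀ x, ∫⁻ t in Set.Ioi (0:ℝ), ENNReal.ofReal (t ^ (-(1/2):ℝ)) * U t x =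
      (∫⁻ t in Set.Ioc 0 T, ENNReal.ofReal (t ^ (-(1/2):ℝ)) * U t x) +
      ∫⁻ t in Set.Ioi T, ENNReal.ofReal (t ^ (-(3/2):ℝ)) * (ENNReal.ofReal t * U t x) := by
    intro x
    rw [← Set.Ioc_union_Ioi_eq_Ioi hT.le, lintegral_union measurableSet_Ioi
      (Set.Ioc_disjoint_Ioi le_rfl)]
    congr 1
    refine setLIntegral_congr_fun measurableSet_Ioi fun t ht => ?_
    have ht' : 0 < t := hT.trans ht
    rw [← mul_assoc, ← ENNReal.ofReal_mul (by positivity), ← Real.rpow_add_one ht'.ne']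
    norm_num
  have hsq : ∀ a b : ℝ≥0∞, (a + b) ^ 2 ≤ 2 * a ^ 2 + 2 * b ^ 2 := by
    intro a b
    have := ENNReal.rpow_add_le_mul_rpow_add_rpow a b (p := 2) (by norm_num)
    rw [mul_add] at this
    norm_num at this
    simpa using this
  have hm : Measurable fun x => ∫⁻ t in Set.Ioc 0 T, ENNReal.ofReal (t ^ (-(1/2):ℝ)) * U t x := by
    have hV' : Measurable fun p : ℝ × ℝ => U p.2 p.1 := hU.comp measurable_swap
    apply Measurable.lintegral_prod_right'
      (f := fun p : ℝ × ℝ => ENNReal.ofReal (p.2 ^ (-(1/2):ℝ)) * U p.2 p.1)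
    fun_prop
  have hT2 : (T ^ (1/2:ℝ)) ^ 2 = T := by
    rw [← Real.rpow_natCast, ← Real.rpow_mul hT.le]; norm_num
  have hT3 : (T ^ (-(1/2):ℝ)) ^ 2 = T⁻¹ := by
    rw [← Real.rpow_natCast, ← Real.rpow_mul hT.le]; norm_num [Real.rpow_neg_one]
  have two : (2:ℝ≥0∞) = ENNReal.ofReal 2 := by simp
  calc _ ≤ ∫⁻ x, (2 * ((∫⁻ t in Set.Ioc 0 T, ENNReal.ofReal (t ^ (-(1/2):ℝ)) * U t x) ^ 2 * W x) +
        2 * ((∫⁻ t in Set.Ioi T, ENNReal.ofReal (t ^ (-(3/2):ℝ)) * (ENNReal.ofReal t * U t x)) ^ 2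
          * W x)) := by
        refine lintegral_mono fun x => ?_
        rw [hsplit, ← mul_assoc, ← mul_assoc, ← add_mul]
        gcongr
        exact hsq _ _
    _ ≤ 2 * (ENNReal.ofReal (2 * T ^ (1/2:ℝ)) ^ 2 * B) +
        2 * (ENNReal.ofReal (2 * T ^ (-(1/2):ℝ)) ^ 2 * A) := by
        rw [lintegral_add_left (by fun_prop), lintegral_const_mul' _ _ (by simp),
          lintegral_const_mul' _ _ (by simp)]
        gcongr
    _ = _ := by
        rw [← mul_assoc, ← mul_assoc, ← ENNReal.ofReal_pow (by positivity),
          ← ENNReal.ofReal_pow (by positivity), two, ← ENNReal.ofReal_mul (by norm_num),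
          ← ENNReal.ofReal_mul (by norm_num), mul_pow, mul_pow, hT2, hT3]
        congr 3
        · ring
        · ring

lemma aux_opt {X A B : ℝ} (hA : 0 ≤ A) (hB : 0 ≤ B) (h : ∀ T > 0, X ≤ T * B + A / T) :
    X ≤ 2 * (Real.sqrt A * Real.sqrt B) := by
  have h1 : ∀ ε > 0, X ≤ 2 * (Real.sqrt (A + ε) * Real.sqrt (B + ε)) := by
    intro ε hε
    have ha : 0 < Real.sqrt (A + ε) := Real.sqrt_pos.mpr (by linarith)
    have hb : 0 < Real.sqrt (B + ε) := Real.sqrt_pos.mpr (by linarith)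
    have ea : Real.sqrt (A + ε) ^ 2 = A + ε := Real.sq_sqrt (by linarith)
    have eb : Real.sqrt (B + ε) ^ 2 = B + ε := Real.sq_sqrt (by linarith)
    set a := Real.sqrt (A + ε)
    set b := Real.sqrt (B + ε)
    calc X ≤ a / b * B + A / (a / b) := h _ (by positivity)
      _ ≤ a / b * b ^ 2 + a ^ 2 / (a / b) := by
          rw [ea, eb]
          gcongr <;> linarith
      _ = _ := by field_simp; ring
  have hc : Continuous fun ε : ℝ => 2 * (Real.sqrt (A + ε) * Real.sqrt (B + ε)) := by fun_prop
  have ht := (hc.tendsto 0).mono_left (nhdsWithin_le_nhds (s := Set.Ioi 0))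
  simp only [add_zero] at ht
  refine ge_of_tendsto ht ?_
  filter_upwards [self_mem_nhdsWithin] with ε hε using h1 ε hε

lemma aux_ofReal_int {g : ℝ → ℝ} (hg : ∀ x, 0 ≤ g x) :
    ENNReal.ofReal (∫ x, g x) ≤ ∫⁻ x, ENNReal.ofReal (g x) := by
  by_cases h : Integrable g
  · rw [ofReal_integral_eq_lintegral_ofReal h (Filter.Eventually.of_forall hg)]
  · rw [integral_undef h]; simp

/-- Weighted Gagliardo–Nirenberg inequality:
`‖Λ^{1/2} f‖_{L²(w_β dx)} ≤ C ‖f‖^{1/2}_{L²(w_β dx)} ‖Λ f‖^{1/2}_{L²(w_β dx)}`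
for real Schwartz `f` and `0 < β < 1`. -/
theorem weighted_GN_half (β : ℝ) (hβ0 : 0 < β) (hβ1 : β < 1) :
    ∃ C > 0, ∀ f : SchwartzMap ℝ ℝ,
      (∫ x : ℝ, ‖fracLap (1 / 2) (fun y => (f y : ℂ)) x‖ ^ 2 * wbeta β x) ^ ((1 : ℝ) / 2) ≤
        C * (∫ x : ℝ, |f x| ^ 2 * wbeta β x) ^ ((1 : ℝ) / 4) *
          (∫ x : ℝ, ‖fracLap 1 (fun y => (f y : ℂ)) x‖ ^ 2 * wbeta β x) ^ ((1 : ℝ) / 4) := by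
  obtain ⟨C, hC0, hC⟩ := aux_A1 hβ0 hβ1
  set D := Real.pi * C with hD
  have hD0 : 0 < D := by positivity
  refine ⟨(16 * D) ^ ((1:ℝ)/2), by positivity, fun f => ?_⟩
  obtain ⟨Φ, hΦ⟩ := aux_schwartz f
  set g : ℝ → ℂ := fun y => (f y : ℂ) with hg
  have hF : Continuous (fourierTrans g) := by rw [hΦ]; exact Φ.continuous
  have hgi : Integrable g := f.integrable.ofReal
  have hgm : Measurable g := by have := f.continuous; rw [hg]; fun_prop
  have hG1 : Integrable (fun ξ : ℝ => ((|ξ| : ℝ) : ℂ) * fourierTrans g ξ) := by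
    refine (schw_int Φ).mono (by fun_prop) (Filter.Eventually.of_forall fun ξ => ?_)
    simp [hΦ]
  have hG2 : Integrable (fun ξ : ℝ => |ξ| ^ (1/2:ℝ) * ‖fourierTrans g ξ‖) := by
    have hr : Continuous fun ξ : ℝ => |ξ| ^ (1/2:ℝ) :=
      Continuous.rpow_const (by fun_prop) (fun _ => Or.inr (by norm_num))
    refine ((schw_int Φ).norm.add Φ.integrable.norm).mono (by fun_prop)
      (Filter.Eventually.of_forall fun ξ => ?_)
    rw [Real.norm_of_nonneg (by positivity), Pi.add_apply, Real.norm_of_nonneg (by positivity),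
      hΦ, norm_mul, Complex.norm_real, Real.norm_eq_abs]
    have : |ξ| ^ (1/2:ℝ) ≤ |ξ| + 1 := by
      rw [← Real.sqrt_eq_rpow]
      rw [Real.sqrt_le_left (by positivity)]
      nlinarith [abs_nonneg ξ]
    nlinarith [norm_nonneg (Φ ξ)]
  have hW := wbeta_cont β
  have hsq : ∀ (z : ℂ) (x : ℝ), ENNReal.ofReal (‖z‖ ^ 2 * wbeta β x) =
      ‖z‖ₑ ^ 2 * ENNReal.ofReal (wbeta β x) := fun z x => by
    rw [ENNReal.ofReal_mul (by positivity), ENNReal.ofReal_pow (norm_nonneg _), ofReal_norm]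
  have hLm := fracLap_meas hF (s := 1) one_pos
  have hLi : Integrable (fun x => ‖fracLap 1 g x‖ ^ 2 * wbeta β x) := by
    refine (aux_decay hΦ).mul_bdd (c := 1) hW.aestronglyMeasurable
      (Filter.Eventually.of_forall fun x => ?_)
    rw [Real.norm_of_nonneg (wbeta_nonneg β x)]
    exact wbeta_le_one hβ0 x
  have hfi : Integrable (fun x => ‖g x‖ ^ 2 * wbeta β x) := by
    have h2 : Integrable (fun x => ‖g x‖ ^ 2) := by
      have := (f.memLp 2 volume).integrable_norm_pow (by norm_num)
      simpa [hg] using this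
    refine h2.mul_bdd (c := 1) hW.aestronglyMeasurable
      (Filter.Eventually.of_forall fun x => ?_)
    rw [Real.norm_of_nonneg (wbeta_nonneg β x)]
    exact wbeta_le_one hβ0 x
  have hfe : ∫ x : ℝ, |f x| ^ 2 * wbeta β x = ∫ x : ℝ, ‖g x‖ ^ 2 * wbeta β x := by
    simp [hg]
  rw [hfe]
  set L := ∫ x : ℝ, ‖fracLap (1 / 2) g x‖ ^ 2 * wbeta β x with hLdef
  set A := ∫ x : ℝ, ‖g x‖ ^ 2 * wbeta β x with hAdef
  set B := ∫ x : ℝ, ‖fracLap 1 g x‖ ^ 2 * wbeta β x with hBdef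
  have hnn : ∀ (h : ℝ → ℂ) (x : ℝ), 0 ≤ ‖h x‖ ^ 2 * wbeta β x := fun h x =>
    mul_nonneg (by positivity) (wbeta_nonneg β x)
  have hA0 : 0 ≤ A := integral_nonneg (hnn g)
  have hB0 : 0 ≤ B := integral_nonneg (hnn _)
  have hL0 : 0 ≤ L := integral_nonneg (hnn _)
  have eA : ∫⁻ x, ‖g x‖ₑ ^ 2 * ENNReal.ofReal (wbeta β x) = ENNReal.ofReal A := by
    rw [hAdef, ofReal_integral_eq_lintegral_ofReal hfi (Filter.Eventually.of_forall (hnn _))]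
    simp_rw [hsq]
  have eB : ∫⁻ x, ‖fracLap 1 g x‖ₑ ^ 2 * ENNReal.ofReal (wbeta β x) = ENNReal.ofReal B := by
    rw [hBdef, ofReal_integral_eq_lintegral_ofReal hLi (Filter.Eventually.of_forall (hnn _))]
    simp_rw [hsq]
  have key : ∀ T > 0, L / (8 * D) ≤ T * B + A / T := by
    intro T hT
    have hcore := aux_core (U := fun t x => ‖uP g t x‖ₑ)
      (W := fun x => ENNReal.ofReal (wbeta β x))
      (A := ENNReal.ofReal D * ENNReal.ofReal A) (B := ENNReal.ofReal D * ENNReal.ofReal B)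
      (uP_meas hF).measurable.enorm (by have := hW.measurable; fun_prop)
      (by
        intro t ht
        rw [← eB, hD, ENNReal.ofReal_mul Real.pi_pos.le]
        refine le_trans ?_ (aux_conv hC ht hLm.measurable.enorm)
        gcongr with x
        exact rep1 hG1 ht x)
      (by
        intro t ht
        rw [← eA, hD, ENNReal.ofReal_mul Real.pi_pos.le]
        refine le_trans ?_ (aux_conv hC ht hgm.enorm)
        gcongr with x
        exact rep2 hgi ht x) hT
    have hle : ENNReal.ofReal L ≤ ENNReal.ofReal (8 * T * (D * B) + 8 / T * (D * A)) := by
      rw [ENNReal.ofReal_add (by positivity) (by positivity), ENNReal.ofReal_mul (p := 8 * T) (by positivity),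
        ENNReal.ofReal_mul (p := D) (q := B) (by positivity), ENNReal.ofReal_mul (p := 8 / T) (by positivity),
        ENNReal.ofReal_mul (q := A) (by positivity)]
      refine le_trans ?_ hcore
      refine (aux_ofReal_int (hnn _)).trans ?_
      simp_rw [hsq]
      gcongr with x
      exact rep0 hF hG2 x
    rw [ENNReal.ofReal_le_ofReal_iff (by positivity)] at hle
    rw [div_le_iff₀ (by positivity)]
    calc L ≤ _ := hle
      _ = _ := by field_simp
  have hfin := aux_opt hA0 hB0 key
  rw [div_le_iff₀ (by positivity)] at hfin
  have hq : ∀ y : ℝ, 0 ≤ y → (Real.sqrt y) ^ ((1:ℝ)/2) = y ^ ((1:ℝ)/4) := by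
    intro y hy
    rw [Real.sqrt_eq_rpow, ← Real.rpow_mul hy]; norm_num
  calc L ^ ((1:ℝ)/2) ≤ (16 * D * Real.sqrt A * Real.sqrt B) ^ ((1:ℝ)/2) := by
        apply Real.rpow_le_rpow hL0 _ (by norm_num)
        linarith
    _ = _ := by
        rw [Real.mul_rpow (by positivity) (by positivity), Real.mul_rpow (by positivity)
          (by positivity), hq A hA0, hq B hB0]
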